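/- Let X and Y be real Banach spaces of dimension greater than or equal to 2 such that the pair (X, Y) has property (P2). Let Y₀ be a (closed) linear subspace of Y with dim Y₀ = 2, and let X₀ be a closed linear subspace of X with dim(X/X₀) = 2. Then the pair (X/X₀, Y₀) (with X/X₀ carrying the quotient norm and Y₀ the induced norm) has property (P2). -/

import Mathlib

/-- The pair `(X, Y)` has property (P2) if for every `ε > 0` there is `η > 0` such
that whenever a norm-one operator `T : X → Y` and `x₀ ∈ S_X` satisfy
`‖T x₀‖ > 1 - η`, there is `x₁ ∈ S_X` with `‖T x₁‖ = 1` and `‖x₁ - x₀‖ < ε`. -/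
def PropertyP2 (X Y : Type*) [NormedAddCommGroup X] [NormedSpace ℝ X]
    [NormedAddCommGroup Y] [NormedSpace ℝ Y] : Prop :=
  ∀ ε > (0 : ℝ), ∃ η > (0 : ℝ), ∀ (T : X →L[ℝ] Y) (x₀ : X),
    ‖T‖ = 1 → ‖x₀‖ = 1 → ‖T x₀‖ > 1 - η →
    ∃ x₁ : X, ‖x₁‖ = 1 ∧ ‖T x₁‖ = 1 ∧ ‖x₁ - x₀‖ < ε

/-- If `(X, Y)` has property (P2), `Y₀ ≤ Y` with `dim Y₀ = 2`, and `X₀ ≤ X` is closed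
with `dim (X ⧸ X₀) = 2`, then the pair `(X ⧸ X₀, Y₀)` has property (P2). -/
theorem propertyP2_quotient_subspace
    {X Y : Type*} [NormedAddCommGroup X] [NormedSpace ℝ X] [CompleteSpace X]
    [NormedAddCommGroup Y] [NormedSpace ℝ Y] [CompleteSpace Y]
    (hX : 2 ≤ Module.rank ℝ X) (hY : 2 ≤ Module.rank ℝ Y)
    (h : PropertyP2 X Y)
    (Y₀ : Submodule ℝ Y) (hY₀ : Module.finrank ℝ Y₀ = 2)
    (X₀ : Submodule ℝ X) [hX₀closed : IsClosed (X₀ : Set X)]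
    (hX₀ : Module.finrank ℝ (X ⧸ X₀) = 2) :
    PropertyP2 (X ⧸ X₀) Y₀ := by
  intro ε hε
  obtain ⟨η, hη, H⟩ := h (ε / 2) (half_pos hε)
  refine ⟨η, hη, ?_⟩
  intro T x₀ hT hx₀ hTx
  let q : X →L[ℝ] (X ⧸ X₀) := X₀.mkQ.mkContinuous 1
    (fun x => by rw [one_mul]; exact Submodule.Quotient.norm_mk_le X₀ x)
  have hq : ∀ x, ‖q x‖ ≤ ‖x‖ := fun x => Submodule.Quotient.norm_mk_le X₀ x
  have hlift : ∀ (y : X ⧸ X₀) (δ : ℝ), 0 < δ → ∃ x : X, q x = y ∧ ‖x‖ < ‖y‖ + δ :=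
    fun y δ hδ => Submodule.Quotient.norm_mk_lt y hδ
  let S : X →L[ℝ] Y := (Y₀.subtypeL.comp T).comp q
  have hS : ∀ x, ‖S x‖ = ‖T (q x)‖ := fun x => rfl
  have hS1 : ‖S‖ = 1 := by
    apply le_antisymm
    · refine S.opNorm_le_bound zero_le_one fun x => ?_
      rw [hS]
      calc ‖T (q x)‖ ≤ ‖T‖ * ‖q x‖ := T.le_opNorm _
        _ ≤ 1 * ‖x‖ := by rw [hT, one_mul, one_mul]; exact hq x
    · rw [← hT]
      refine T.opNorm_le_bound (norm_nonneg _) fun y => ?_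
      refine le_of_forall_pos_le_add fun δ hδ => ?_
      have hpos : 0 < ‖S‖ + 1 := by positivity
      obtain ⟨x, rfl, hx⟩ := hlift y (δ / (‖S‖ + 1)) (by positivity)
      have h1 : ‖T (q x)‖ ≤ ‖S‖ * ‖x‖ := S.le_opNorm x
      have h2 : ‖S‖ * ‖x‖ ≤ ‖S‖ * (‖q x‖ + δ / (‖S‖ + 1)) :=
        mul_le_mul_of_nonneg_left hx.le (norm_nonneg _)
      have h3 : (‖S‖ + 1) * (δ / (‖S‖ + 1)) = δ := by field_simp
      have h4 : 0 < δ / (‖S‖ + 1) := by positivity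
      linarith
  obtain ⟨x, hqx, hx⟩ := hlift x₀ (min (ε / 2) (‖T x₀‖ - (1 - η)))
    (lt_min (half_pos hε) (by linarith))
  have hr1 : 1 ≤ ‖x‖ := by rw [← hx₀, ← hqx]; exact hq x
  have hr0 : 0 < ‖x‖ := by linarith
  have hxa : ‖x‖ - 1 < ε / 2 := by
    have := min_le_left (ε / 2) (‖T x₀‖ - (1 - η)); linarith
  have hxb : ‖x‖ - 1 < ‖T x₀‖ - (1 - η) := by
    have := min_le_right (ε / 2) (‖T x₀‖ - (1 - η)); linarith
  obtain ⟨x₁, hx₁, hSx₁, hd⟩ := H S (‖x‖⁻¹ • x) hS1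
    (by rw [norm_smul, norm_inv, norm_norm, inv_mul_cancel₀ hr0.ne'])
    (by
      rw [hS, map_smul, hqx, map_smul, norm_smul, norm_inv, norm_norm, gt_iff_lt,
        inv_mul_eq_div, lt_div_iff₀ hr0]
      nlinarith)
  rw [hS] at hSx₁
  refine ⟨q x₁, le_antisymm (hx₁ ▸ hq x₁) ?_, hSx₁, ?_⟩
  · have := T.le_opNorm (q x₁)
    rw [hT, one_mul, hSx₁] at this
    exact this
  · have e : q x₁ - x₀ = q (x₁ - ‖x‖⁻¹ • x) + (‖x‖⁻¹ - 1) • x₀ := by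
      rw [map_sub, map_smul, hqx, sub_smul, one_smul]; abel
    have h5 : ‖x‖⁻¹ ≤ 1 := inv_le_one_of_one_le₀ hr1
    have h6 : 1 - ‖x‖⁻¹ ≤ ‖x‖ - 1 := by
      have : ‖x‖ * ‖x‖⁻¹ = 1 := mul_inv_cancel₀ hr0.ne'
      nlinarith
    have h7 : ‖(‖x‖⁻¹ - 1) • x₀‖ = 1 - ‖x‖⁻¹ := by
      rw [norm_smul, hx₀, mul_one, Real.norm_eq_abs, abs_of_nonpos (by linarith)]; ring
    rw [e]
    have h8 := norm_add_le (q (x₁ - ‖x‖⁻¹ • x)) ((‖x‖⁻¹ - 1) • x₀)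
    have h9 := hq (x₁ - ‖x‖⁻¹ • x)
    linarith
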